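/- There exists a sequence of positive stepsizes (α_t)_{t≥1}, constructed independently of the stopping time, and a universal constant C > 0 such that: for every dimension d, every convex differentiable function f: ℝ^d → ℝ whose gradient is 1-Lipschitz and which attains its minimum at some x*, every initialization x_1 ∈ ℝ^d, and the gradient descent iterates x_{t+1} = x_t − α_t ∇f(x_t), one has f(x_T) − f(x*) ≤ C‖x_1 − x*‖²/T^θ for every integer T ≥ 1, where θ = 2·log₂(1+√2)/(1 + log₂(1+√2)) ≈ 1.119. -/

import Mathlib

open Finset
open scoped RealInnerProductSpace

noncomputable section

/-- Gradient-descent trajectory along a finite list of stepsizes. -/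
def gdIter {E : Type*} [AddCommGroup E] [SMul ℝ E] (g : E → E) : E → List ℝ → E
  | x, [] => x
  | x, a :: L => gdIter g (x - a • g x) L

/-- A finite stepsize schedule (of positive reals) is primitive if the key
gradient-descent inequality holds for every smooth convex problem instance. -/
def IsPrimitive (L : List ℝ) : Prop :=
  (∀ a ∈ L, (0:ℝ) < a) ∧
  ∀ (d : ℕ) (f : EuclideanSpace ℝ (Fin d) → ℝ)
    (g : EuclideanSpace ℝ (Fin d) → EuclideanSpace ℝ (Fin d)),
    ConvexOn ℝ Set.univ f →
    (∀ y, HasGradientAt f (g y) y) →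
    LipschitzWith 1 g →
    ∀ xstar : EuclideanSpace ℝ (Fin d), IsMinOn f Set.univ xstar →
    ∀ x1 : EuclideanSpace ℝ (Fin d),
      L.sum * (f (gdIter g x1 L) - f xstar)
        + (L.sum * (L.sum + 1) / 2) * ‖g (gdIter g x1 L)‖ ^ 2
        + 2⁻¹ * ‖gdIter g x1 L - xstar‖ ^ 2
      ≤ 2⁻¹ * ‖x1 - xstar‖ ^ 2
        + ∑ i : Fin L.length,
            L.get i *
              (f (gdIter g x1 (L.take i.1)) - f xstar
                - ⟪g (gdIter g x1 (L.take i.1)), gdIter g x1 (L.take i.1) - xstar⟫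
                + 2⁻¹ * ‖g (gdIter g x1 (L.take i.1))‖ ^ 2)

/-- The join-stepsize function. -/
def phi (x y : ℝ) : ℝ :=
  (-(x + y) + Real.sqrt ((x + y + 2) ^ 2 + 4 * (x + 1) * (y + 1))) / 2

/-- Concatenation of two stepsize schedules with the join stepsize in between. -/
def concatSched (s r : List ℝ) : List ℝ := s ++ phi s.sum r.sum :: r

/-- The silver stepsize schedules. -/
def silver : ℕ → List ℝ
  | 0 => []
  | i + 1 => concatSched (silver i) (silver i)

/-- Recursive concatenation of a sequence of schedules. -/
def concatAll (s : ℕ → List ℝ) : ℕ → List ℝ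
  | 0 => []
  | i + 1 => concatSched (concatAll s i) (s (i + 1))

/-- The number of copies of the `j`-th silver schedule. -/
def kSeq (c : ℝ) (j : ℕ) : ℕ := ⌊2 * (2:ℝ) ^ (c * j)⌋₊

def MSeq (c : ℝ) (j : ℕ) : ℕ := ∑ j' ∈ Finset.Icc 1 j, kSeq c j'

/-- The block index `j` of `i`, i.e. the `j` with `M_{j-1} < i ≤ M_j`. -/
def blockIdx (c : ℝ) (i : ℕ) : ℕ := sInf {j | i ≤ MSeq c j}

/-- The partially concatenated schedules `ŝ_i`. -/
def shatSched (c : ℝ) : ℕ → List ℝ := concatAll fun i => silver (blockIdx c i)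

/-- The `t`-th entry (1-indexed) of the infinite limiting schedule `ŝ`. -/
def shatEntry (c : ℝ) (t : ℕ) : ℝ := (shatSched c t).getD (t - 1) 0

variable {E : Type*} [NormedAddCommGroup E] [InnerProductSpace ℝ E]

local notation "ρ" => (1 + Real.sqrt 2)

/-! ### Smooth convex functions -/

/-- The interpolation inequality characterizing `1`-smooth convex functions `f` with gradient `g`. -/
def Cocoercive (f : E → ℝ) (g : E → E) : Prop :=
  ∀ x y, f x + ⟪g x, y - x⟫ + 2⁻¹ * ‖g x - g y‖ ^ 2 ≤ f y

lemma hasDerivAt_comp_line [CompleteSpace E] {f : E → ℝ} {g : E → E}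
    (hg : ∀ y, HasGradientAt f (g y) y) (x v : E) (t : ℝ) :
    HasDerivAt (fun s : ℝ => f (x + s • v)) ⟪g (x + t • v), v⟫ t := by
  have h1 : HasDerivAt (fun s : ℝ => x + s • v) v t := by
    simpa using ((hasDerivAt_id t).smul_const v).const_add x
  have h2 := (hg (x + t • v)).hasFDerivAt.comp_hasDerivAt t h1
  exact h2

lemma ConvexOn.add_inner_gradient_le [CompleteSpace E] {f : E → ℝ} {g : E → E}
    (hf : ConvexOn ℝ Set.univ f) (hg : ∀ y, HasGradientAt f (g y) y) (x y : E) :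
    f x + ⟪g x, y - x⟫ ≤ f y := by
  have hc : ConvexOn ℝ Set.univ fun s : ℝ => f (x + s • (y - x)) := by
    have h := hf.comp_affineMap (AffineMap.lineMap x y : ℝ →ᵃ[ℝ] E)
    have e : f ∘ (AffineMap.lineMap x y : ℝ →ᵃ[ℝ] E) = fun s : ℝ => f (x + s • (y - x)) := by
      ext s
      simp [AffineMap.lineMap_apply, add_comm]
    rwa [e] at h
  have h := hc.le_slope_of_hasDerivAt (Set.mem_univ 0) (Set.mem_univ 1) zero_lt_one
    (hasDerivAt_comp_line hg x (y - x) 0)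
  simp [slope_def_field] at h
  linarith

lemma LipschitzWith.le_add_inner_gradient_add [CompleteSpace E] {f : E → ℝ} {g : E → E}
    (hg : ∀ y, HasGradientAt f (g y) y) (hl : LipschitzWith 1 g) (x y : E) :
    f y ≤ f x + ⟪g x, y - x⟫ + 2⁻¹ * ‖y - x‖ ^ 2 := by
  set v := y - x with hv
  have hd : ∀ t : ℝ, HasDerivAt
      (fun s : ℝ => f (x + s • v) - (s * ⟪g x, v⟫ + 2⁻¹ * s ^ 2 * ‖v‖ ^ 2))
      (⟪g (x + t • v), v⟫ - (⟪g x, v⟫ + t * ‖v‖ ^ 2)) t := by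
    intro t
    refine (hasDerivAt_comp_line hg x v t).sub ?_
    refine (((hasDerivAt_id t).mul_const ⟪g x, v⟫).add
      ((((hasDerivAt_id t).pow 2).const_mul (2⁻¹ : ℝ)).mul_const (‖v‖ ^ 2))).congr_deriv ?_
    simp
  have ha : AntitoneOn
      (fun s : ℝ => f (x + s • v) - (s * ⟪g x, v⟫ + 2⁻¹ * s ^ 2 * ‖v‖ ^ 2)) (Set.Icc 0 1) := by
    refine antitoneOn_of_deriv_nonpos (convex_Icc 0 1)
      (fun t _ => (hd t).continuousAt.continuousWithinAt)
      (fun t _ => (hd t).differentiableAt.differentiableWithinAt) fun t ht => ?_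
    rw [interior_Icc] at ht
    rw [(hd t).deriv]
    have h1 : ⟪g (x + t • v) - g x, v⟫ ≤ t * ‖v‖ ^ 2 := by
      refine (real_inner_le_norm _ _).trans ?_
      have h2 : ‖g (x + t • v) - g x‖ ≤ t * ‖v‖ := by
        simpa [dist_eq_norm, norm_smul, abs_of_pos ht.1] using hl.dist_le_mul (x + t • v) x
      nlinarith [norm_nonneg v]
    rw [inner_sub_left] at h1
    linarith
  have h := ha (Set.left_mem_Icc.2 zero_le_one) (Set.right_mem_Icc.2 zero_le_one) zero_le_one
  have hy : x + v = y := by simp [hv]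
  simp [hy] at h
  linarith

lemma ConvexOn.cocoercive [CompleteSpace E] {f : E → ℝ} {g : E → E}
    (hf : ConvexOn ℝ Set.univ f) (hg : ∀ y, HasGradientAt f (g y) y) (hl : LipschitzWith 1 g) :
    Cocoercive f g := by
  intro x y
  have h1 := hf.add_inner_gradient_le hg x (y - (g y - g x))
  have h2 := hl.le_add_inner_gradient_add hg y (y - (g y - g x))
  have h3 : ‖g y - g x‖ ^ 2 = ⟪g y, g y - g x⟫ - ⟪g x, g y - g x⟫ := by
    rw [← inner_sub_left, real_inner_self_eq_norm_sq]
  have e1 : y - (g y - g x) - x = (y - x) - (g y - g x) := by abel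
  have e2 : y - (g y - g x) - y = -(g y - g x) := by abel
  rw [e1, inner_sub_right] at h1
  rw [e2, inner_neg_right, norm_neg] at h2
  rw [norm_sub_rev]
  linarith

lemma gradient_eq_zero_of_isMinOn [CompleteSpace E] {f : E → ℝ} {g : E → E}
    (hg : ∀ y, HasGradientAt f (g y) y) {u : E} (hu : IsMinOn f Set.univ u) : g u = 0 := by
  have h := (hu.isLocalMin Filter.univ_mem).hasFDerivAt_eq_zero (hg u).hasFDerivAt
  simpa using h

/-! ### Primitive schedules -/

/-- The weighted sum of first-order residuals, relative to `u`, along a gradient-descent run. -/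
def gdResidual (f : E → ℝ) (g : E → E) (u : E) : E → List ℝ → ℝ
  | _, [] => 0
  | x, a :: L =>
    a * (f x - f u - ⟪g x, x - u⟫ + 2⁻¹ * ‖g x‖ ^ 2) + gdResidual f g u (x - a • g x) L

/-- The inequality of `IsPrimitive` for a single instance `f`, relative to arbitrary points. -/
def PrimitiveFor (f : E → ℝ) (g : E → E) (L : List ℝ) : Prop :=
  ∀ x u : E, L.sum * (f (gdIter g x L) - f u)
      + (L.sum * (L.sum + 1) / 2) * ‖g (gdIter g x L)‖ ^ 2 + 2⁻¹ * ‖gdIter g x L - u‖ ^ 2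
    ≤ 2⁻¹ * ‖x - u‖ ^ 2 + gdResidual f g u x L

lemma gdIter_append (g : E → E) (x : E) (s r : List ℝ) :
    gdIter g x (s ++ r) = gdIter g (gdIter g x s) r := by
  induction s generalizing x with
  | nil => rfl
  | cons a s ih => exact ih _

lemma gdResidual_append (f : E → ℝ) (g : E → E) (u x : E) (s r : List ℝ) :
    gdResidual f g u x (s ++ r) = gdResidual f g u x s + gdResidual f g u (gdIter g x s) r := by
  induction s generalizing x with
  | nil => simp [gdResidual, gdIter]
  | cons a s ih => simp [gdResidual, gdIter, ih, add_assoc]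

lemma Cocoercive.gdResidual_le {f : E → ℝ} {g : E → E} (h : Cocoercive f g) {L : List ℝ}
    (hL : ∀ a ∈ L, 0 < a) (u x : E) :
    gdResidual f g u x L ≤ ⟪x - gdIter g x L, g u⟫ - L.sum / 2 * ‖g u‖ ^ 2 := by
  induction L generalizing x with
  | nil => simp [gdResidual, gdIter]
  | cons a L ih =>
    have h1 := ih (fun b hb => hL b (List.mem_cons_of_mem _ hb)) (x - a • g x)
    have h2 : f x - f u - ⟪g x, x - u⟫ + 2⁻¹ * ‖g x‖ ^ 2 ≤ ⟪g x, g u⟫ - 2⁻¹ * ‖g u‖ ^ 2 := by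
      have h3 := h x u
      rw [norm_sub_sq_real, ← neg_sub x u, inner_neg_right] at h3
      linarith
    have h4 := mul_le_mul_of_nonneg_left h2 (hL a List.mem_cons_self).le
    simp only [gdResidual, gdIter, List.sum_cons, inner_sub_left, real_inner_smul_left] at h1 h4 ⊢
    linarith

lemma PrimitiveFor.le_of_cocoercive {f : E → ℝ} {g : E → E} {L : List ℝ}
    (hp : PrimitiveFor f g L) (h : Cocoercive f g) (hL : ∀ a ∈ L, 0 < a) (x u : E) :
    L.sum * (f (gdIter g x L) - f u)
      + (L.sum * (L.sum + 1) / 2) * ‖g (gdIter g x L)‖ ^ 2 + 2⁻¹ * ‖gdIter g x L - u‖ ^ 2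
    ≤ 2⁻¹ * ‖x - u‖ ^ 2 + ⟪x - gdIter g x L, g u⟫ - L.sum / 2 * ‖g u‖ ^ 2 := by
  linarith [hp x u, h.gdResidual_le hL u x]

lemma primitiveFor_nil (f : E → ℝ) (g : E → E) : PrimitiveFor f g [] := by
  intro x u
  simp [gdResidual, gdIter]

lemma phi_spec {x y : ℝ} (hx : 0 ≤ x) (hy : 0 ≤ y) :
    1 ≤ phi x y ∧ phi x y ≤ y + 2 ∧
      (phi x y - 1) * (x + y + phi x y + 1) = (x + 1) * (y + 1) := by
  have h0 : 0 ≤ (x + y + 2) ^ 2 + 4 * (x + 1) * (y + 1) := by positivity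
  have h1 := Real.sq_sqrt h0
  have h2 : x + y + 2 ≤ √((x + y + 2) ^ 2 + 4 * (x + 1) * (y + 1)) :=
    Real.le_sqrt_of_sq_le (by nlinarith)
  have h3 : √((x + y + 2) ^ 2 + 4 * (x + 1) * (y + 1)) ≤ x + 3 * y + 4 :=
    Real.sqrt_le_iff.2 ⟨by positivity, by nlinarith⟩
  unfold phi
  refine ⟨by linarith, by linarith, by nlinarith⟩

/-- Joining two primitive schedules `s`, `r` with step `β`: the decrease between the end `z` of the
first and the end `e` of the second. -/
lemma PrimitiveFor.join_decrease {f : E → ℝ} {g : E → E} {r : List ℝ} (hr : PrimitiveFor f g r)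
    (h : Cocoercive f g) (hpos : ∀ a ∈ r, 0 < a) (z : E) {β : ℝ} (hβ : 1 ≤ β) :
    2 * (r.sum + 2 - β) * (f (gdIter g (z - β • g z) r) - f z)
      + (2 * (r.sum + 1) ^ 2 - (r.sum + 2 - β)) * ‖g (gdIter g (z - β • g z) r)‖ ^ 2
    ≤ (2 * (β - 1) ^ 2 - (r.sum + 2 - β)) * ‖g z‖ ^ 2 := by
  have hz := hr.le_of_cocoercive h hpos (z - β • g z) z
  have he := hr.le_of_cocoercive h hpos (z - β • g z) (gdIter g (z - β • g z) r)
  set e := gdIter g (z - β • g z) r with he_def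
  obtain ⟨d, hd⟩ : ∃ d, e = z + d := ⟨e - z, by abel⟩
  have q1 := h e z
  have q2 := mul_le_mul_of_nonneg_left (h z e) (sub_nonneg.2 hβ)
  have e1 : z - β • g z - z = -(β • g z) := by abel
  have e2 : z - β • g z - e = -(β • g z + d) := by rw [hd]; abel
  have e3 : e - z = d := by rw [hd]; abel
  have e4 : z - e = -d := by rw [hd]; abel
  rw [e1, e2, e3] at hz
  rw [e2, sub_self e] at he
  rw [e4] at q1
  rw [e3] at q2
  simp only [norm_neg, inner_neg_left, inner_neg_right, norm_add_sq_real, norm_sub_sq_real,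
    inner_add_left, real_inner_smul_left, norm_smul, mul_pow, Real.norm_eq_abs, sq_abs,
    norm_zero, real_inner_self_eq_norm_sq, sub_self] at hz he q1 q2
  rw [real_inner_comm d (g z), real_inner_comm (g e) (g z)] at *
  rw [real_inner_comm d (g e)] at *
  nlinarith

lemma PrimitiveFor.concat {f : E → ℝ} {g : E → E} {s r : List ℝ} (hs : PrimitiveFor f g s)
    (hr : PrimitiveFor f g r) (h : Cocoercive f g) (hs0 : 0 ≤ s.sum) (hr0 : 0 ≤ r.sum)
    (hpos : ∀ a ∈ r, 0 < a) : PrimitiveFor f g (concatSched s r) := by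
  intro x u
  obtain ⟨hβ, hβ', hrel⟩ := phi_spec hs0 hr0
  simp only [concatSched, gdIter_append, gdResidual_append, List.sum_append, List.sum_cons, gdIter,
    gdResidual]
  set β := phi s.sum r.sum
  have h1 := hs x u
  set z := gdIter g x s
  have h2 := hr (z - β • g z) u
  have h3 := hr.join_decrease h hpos z hβ
  set e := gdIter g (z - β • g z) r
  have e1 : z - β • g z - u = (z - u) - β • g z := by abel
  rw [e1, norm_sub_sq_real (z - u), real_inner_smul_right, norm_smul, mul_pow, Real.norm_eq_abs,
    sq_abs, real_inner_comm (g z)] at h2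
  set a := s.sum
  set b := r.sum
  set F := f e - f z
  have hB : 0 < b + 2 - β := by nlinarith
  have h4 : (a + β) * (b + 2 - β) = 2 * (β - 1) * (b + 1) := by nlinarith
  have key : (a + β) * F + (a + β) * (a + 2 * b + β + 1) / 2 * ‖g e‖ ^ 2
      ≤ (a + β) * (a - β + 1) / 2 * ‖g z‖ ^ 2 := by
    refine le_of_mul_le_mul_left ?_ hB
    have h5 : (b + 2 - β) * (a + 2 * b + β + 1) = 2 * (b + 1) ^ 2 - (b + 2 - β) := by nlinarith
    have h6 : (b + 2 - β) * (a - β + 1) = 2 * (β - 1) ^ 2 - (b + 2 - β) := by nlinarith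
    have h7 := mul_le_mul_of_nonneg_left h3 (show 0 ≤ (a + β) / 2 by linarith)
    rw [← h5, ← h6] at h7
    linarith
  simp only [F] at key
  nlinarith

/-! ### Silver schedules -/

lemma phi_self {x : ℝ} (hx : 0 ≤ x) : phi x x = (√2 - 1) * (x + 1) + 1 := by
  have h2 : √2 ^ 2 = 2 := Real.sq_sqrt zero_le_two
  have h : (x + x + 2) ^ 2 + 4 * (x + 1) * (x + 1) = (2 * √2 * (x + 1)) ^ 2 := by
    linear_combination (-4 * (x + 1) ^ 2) * h2
  rw [phi, h, Real.sqrt_sq (by positivity)]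
  ring

lemma one_le_silverRatio_pow (m : ℕ) : 1 ≤ ρ ^ m :=
  one_le_pow₀ (by linarith [Real.sqrt_nonneg 2])

lemma silver_sum (m : ℕ) : (silver m).sum = ρ ^ m - 1 := by
  induction m with
  | zero => simp [silver]
  | succ m ih =>
    have h := one_le_silverRatio_pow m
    rw [silver, concatSched, List.sum_append, List.sum_cons, ih, phi_self (by linarith)]
    ring

lemma silver_sum_nonneg (m : ℕ) : 0 ≤ (silver m).sum := by
  rw [silver_sum]
  linarith [one_le_silverRatio_pow m]

lemma silver_length (m : ℕ) : (silver m).length + 1 = 2 ^ m := by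
  induction m with
  | zero => simp [silver]
  | succ m ih =>
    rw [silver, concatSched, List.length_append, List.length_cons, pow_succ]
    omega

lemma concatSched_pos {s r : List ℝ} (hs : ∀ a ∈ s, 0 < a) (hr : ∀ a ∈ r, 0 < a)
    (hs0 : 0 ≤ s.sum) (hr0 : 0 ≤ r.sum) : ∀ a ∈ concatSched s r, 0 < a := by
  intro a ha
  rcases List.mem_append.1 ha with h | h
  · exact hs a h
  rcases List.mem_cons.1 h with rfl | h
  · linarith [(phi_spec hs0 hr0).1]
  · exact hr a h

lemma silver_pos (m : ℕ) : ∀ a ∈ silver m, 0 < a := by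
  induction m with
  | zero => simp [silver]
  | succ m ih => exact concatSched_pos ih ih (silver_sum_nonneg m) (silver_sum_nonneg m)

lemma Cocoercive.primitiveFor_silver {f : E → ℝ} {g : E → E} (h : Cocoercive f g) (m : ℕ) :
    PrimitiveFor f g (silver m) := by
  induction m with
  | zero => exact primitiveFor_nil f g
  | succ m ih =>
    exact ih.concat ih h (silver_sum_nonneg m) (silver_sum_nonneg m) (silver_pos m)

/-- One gradient step of arbitrary length. -/
lemma Cocoercive.gradient_step {f : E → ℝ} {g : E → E} (h : Cocoercive f g) (u : E) (φ : ℝ) :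
    f (u - φ • g u) - f u ≤ 2⁻¹ * (φ - 1) ^ 2 * ‖g u‖ ^ 2 ∧
      ‖g (u - φ • g u)‖ ^ 2 ≤ ((φ - 1) ^ 2 + 1) * ‖g u‖ ^ 2 := by
  set x := u - φ • g u with hx
  have q1 := h u x
  have q2 := h x u
  have e1 : x - u = -(φ • g u) := by rw [hx]; abel
  have e2 : u - x = φ • g u := by rw [hx]; abel
  rw [e1, norm_sub_sq_real, inner_neg_right, real_inner_smul_right,
    real_inner_self_eq_norm_sq, real_inner_comm (g x)] at q1
  rw [e2, norm_sub_sq_real, real_inner_smul_right] at q2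
  have s1 := sq_nonneg ‖(1 - φ) • g u - g x‖
  have s2 := sq_nonneg ‖(2 - φ) • g u - g x‖
  rw [norm_sub_sq_real, real_inner_smul_left, norm_smul, mul_pow, Real.norm_eq_abs, sq_abs,
    real_inner_comm (g x)] at s1 s2
  constructor <;> nlinarith

/-- A gradient step of arbitrary length followed by a full silver schedule. -/
lemma Cocoercive.silver_step {f : E → ℝ} {g : E → E} (h : Cocoercive f g) (m : ℕ) (u : E) (φ : ℝ) :
    f (gdIter g (u - φ • g u) (silver m)) - f u ≤ 2⁻¹ * (φ - 1) ^ 2 * ‖g u‖ ^ 2 ∧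
      (ρ ^ m) ^ 2 * ‖g (gdIter g (u - φ • g u) (silver m))‖ ^ 2
        ≤ 2 * ((φ - 1) ^ 2 + (ρ ^ m) ^ 2) * ‖g u‖ ^ 2 := by
  rcases m with _ | m
  · obtain ⟨h1, h2⟩ := h.gradient_step u φ
    simp only [silver, gdIter, pow_zero, one_pow, one_mul]
    have h3 : 0 ≤ ((φ - 1) ^ 2 + 1) * ‖g u‖ ^ 2 := by positivity
    exact ⟨h1, by linarith⟩
  have hS : 1 ≤ (silver (m + 1)).sum := by
    have h1 := one_le_silverRatio_pow m
    have h2 : 1 ≤ √2 := Real.one_le_sqrt.2 one_le_two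
    rw [silver_sum, pow_succ]
    nlinarith
  have hr : ρ ^ (m + 1) = (silver (m + 1)).sum + 1 := by rw [silver_sum]; ring
  have hz := (h.primitiveFor_silver (m + 1)).le_of_cocoercive h (silver_pos (m + 1)) (u - φ • g u) u
  rw [hr]
  set e := gdIter g (u - φ • g u) (silver (m + 1))
  set S := (silver (m + 1)).sum
  obtain ⟨d, hd⟩ : ∃ d, e = u + d := ⟨e - u, by abel⟩
  have q := h u e
  have e1 : u - φ • g u - u = -(φ • g u) := by abel
  have e2 : u - φ • g u - e = -(φ • g u + d) := by rw [hd]; abel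
  have e3 : e - u = d := by rw [hd]; abel
  rw [e1, e2, e3, norm_neg, inner_neg_left, inner_add_left, real_inner_smul_left, norm_smul,
    mul_pow, Real.norm_eq_abs, sq_abs, real_inner_self_eq_norm_sq, real_inner_comm (g u)] at hz
  rw [e3] at q
  have s1 := sq_nonneg ‖g u + d‖
  have s2 := sq_nonneg ‖(S + 1) • g u + d‖
  rw [norm_add_sq_real] at s1 s2
  rw [real_inner_smul_left, norm_smul, mul_pow, Real.norm_eq_abs, sq_abs] at s2
  have hG := sq_nonneg ‖g u‖
  have hE := sq_nonneg ‖g e‖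
  have hSE := mul_nonneg (mul_nonneg (zero_le_one.trans hS) (by linarith : 0 ≤ S + 1)) hE
  constructor
  · have h1 : S * (f e - f u) ≤ 2⁻¹ * (φ - 1) ^ 2 * ‖g u‖ ^ 2 := by nlinarith
    by_contra! h2
    have h3 : 0 ≤ 2⁻¹ * (φ - 1) ^ 2 * ‖g u‖ ^ 2 := by positivity
    nlinarith
  · have q' := mul_le_mul_of_nonneg_left q (zero_le_one.trans hS)
    have h0 : 0 ≤ S * ‖g u - g e‖ ^ 2 := mul_nonneg (by linarith) (sq_nonneg _)
    have h1 : S * (S + 1) * ‖g e‖ ^ 2 ≤ ((φ - 1) ^ 2 + (S + 1) ^ 2) * ‖g u‖ ^ 2 := by nlinarith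
    nlinarith

/-- A gradient step of arbitrary length followed by a truncated silver schedule. -/
lemma Cocoercive.silver_take {f : E → ℝ} {g : E → E} (h : Cocoercive f g) (m n : ℕ) (u : E)
    (φ : ℝ) :
    f (gdIter g (u - φ • g u) ((silver m).take n)) - f u
      ≤ (4 * (φ - 1) ^ 2 + (ρ ^ m) ^ 2) * ‖g u‖ ^ 2 := by
  induction m generalizing n u φ with
  | zero =>
    have h1 := (h.gradient_step u φ).1
    have h2 : 0 ≤ (φ - 1) ^ 2 * ‖g u‖ ^ 2 := by positivity
    simp only [silver, List.take_nil, gdIter, pow_zero, one_pow]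
    nlinarith [sq_nonneg ‖g u‖]
  | succ m ih =>
    have hρ : 5 ≤ ρ ^ 2 := by
      nlinarith [Real.sq_sqrt (zero_le_two (α := ℝ)), Real.one_le_sqrt.2 (one_le_two (α := ℝ))]
    have hG := mul_nonneg (sq_nonneg (ρ ^ m)) (sq_nonneg ‖g u‖)
    have hφ := mul_nonneg (sq_nonneg (φ - 1)) (sq_nonneg ‖g u‖)
    have hpow : (ρ ^ (m + 1)) ^ 2 = ρ ^ 2 * (ρ ^ m) ^ 2 := by ring
    have hGρ := mul_le_mul_of_nonneg_right hρ hG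
    rw [hpow]
    rcases le_or_gt n (silver m).length with hn | hn
    · rw [silver, concatSched, List.take_append_of_le_length hn]
      nlinarith [ih n u φ]
    · obtain ⟨k, rfl⟩ := Nat.exists_eq_add_of_lt hn
      rw [silver, concatSched, add_assoc, List.take_length_add_append, List.take_succ_cons,
        gdIter_append]
      obtain ⟨h1, h2⟩ := h.silver_step m u φ
      set e := gdIter g (u - φ • g u) (silver m)
      have h3 := ih k e (phi (silver m).sum (silver m).sum)
      have hφ' : phi (silver m).sum (silver m).sum - 1 = (√2 - 1) * ρ ^ m := by
        rw [phi_self (silver_sum_nonneg m), silver_sum]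
        ring
      rw [hφ'] at h3
      have hc : 4 * (√2 - 1) ^ 2 + 1 ≤ 7 / 4 := by
        have : (1.4 : ℝ) ≤ √2 := Real.le_sqrt_of_sq_le (by norm_num)
        nlinarith [Real.sq_sqrt (zero_le_two (α := ℝ))]
      have h4 := mul_le_mul_of_nonneg_right hc (mul_nonneg (sq_nonneg (ρ ^ m)) (sq_nonneg ‖g e‖))
      simp only [gdIter]
      nlinarith

/-! ### The anytime schedule -/

/-- Concatenation of silver schedules, the order of each being the function `j` of the total
stepsize of its predecessors. -/
def anytimeSched (j : ℝ → ℕ) : ℕ → List ℝ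
  | 0 => []
  | i + 1 => concatSched (anytimeSched j i) (silver (j (anytimeSched j i).sum))

lemma anytimeSched_sum_nonneg (j : ℝ → ℕ) (i : ℕ) : 0 ≤ (anytimeSched j i).sum := by
  induction i with
  | zero => simp [anytimeSched]
  | succ i ih =>
    have h := silver_sum_nonneg (j (anytimeSched j i).sum)
    rw [anytimeSched, concatSched, List.sum_append, List.sum_cons]
    linarith [(phi_spec ih h).1]

lemma anytimeSched_pos (j : ℝ → ℕ) (i : ℕ) : ∀ a ∈ anytimeSched j i, 0 < a := by
  induction i with
  | zero => simp [anytimeSched]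
  | succ i ih =>
    exact concatSched_pos ih (silver_pos _) (anytimeSched_sum_nonneg j i) (silver_sum_nonneg _)

lemma Cocoercive.primitiveFor_anytimeSched {f : E → ℝ} {g : E → E} (h : Cocoercive f g)
    (j : ℝ → ℕ) (i : ℕ) : PrimitiveFor f g (anytimeSched j i) := by
  induction i with
  | zero => exact primitiveFor_nil f g
  | succ i ih =>
    exact ih.concat (h.primitiveFor_silver _) h (anytimeSched_sum_nonneg j i)
      (silver_sum_nonneg _) (silver_pos _)

lemma anytimeSched_length_succ (j : ℝ → ℕ) (i : ℕ) : (anytimeSched j (i + 1)).length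
    = (anytimeSched j i).length + 2 ^ j (anytimeSched j i).sum := by
  rw [anytimeSched, concatSched, List.length_append, List.length_cons, silver_length]

lemma le_anytimeSched_length (j : ℝ → ℕ) (i : ℕ) : i ≤ (anytimeSched j i).length := by
  induction i with
  | zero => simp
  | succ i ih =>
    rw [anytimeSched_length_succ]
    have := Nat.one_le_two_pow (n := j (anytimeSched j i).sum)
    omega

lemma anytimeSched_prefix (j : ℝ → ℕ) {i k : ℕ} (hik : i ≤ k) :
    anytimeSched j i <+: anytimeSched j k := by
  induction hik with
  | refl => exact List.prefix_rfl
  | step _ ih => exact ih.trans (List.prefix_append _ _)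

lemma anytimeSched_sum_eq_zero_or (j : ℝ → ℕ) (i : ℕ) :
    anytimeSched j i = [] ∨ 1 ≤ (anytimeSched j i).sum := by
  rcases i with _ | i
  · exact Or.inl rfl
  · right
    have h1 := anytimeSched_sum_nonneg j i
    have h2 := silver_sum_nonneg (j (anytimeSched j i).sum)
    rw [anytimeSched, concatSched, List.sum_append, List.sum_cons]
    linarith [(phi_spec h1 h2).1]

/-- The infinite schedule, indexed from `1`, with the finite schedules `anytimeSched j i` as
prefixes. -/
def anytimeStep (j : ℝ → ℕ) (t : ℕ) : ℝ := (anytimeSched j t).getD (t - 1) 1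

lemma anytimeStep_pos (j : ℝ → ℕ) (t : ℕ) : 0 < anytimeStep j t := by
  rw [anytimeStep, List.getD_eq_getElem?_getD]
  rcases h : (anytimeSched j t)[t - 1]? with _ | a
  · simp
  · exact anytimeSched_pos j t a (List.mem_of_getElem? h)

lemma getElem_anytimeSched (j : ℝ → ℕ) {i n : ℕ} (hn : n < (anytimeSched j i).length) :
    (anytimeSched j i)[n] = anytimeStep j (n + 1) := by
  have hn' : n < (anytimeSched j (n + 1)).length := le_anytimeSched_length j (n + 1)
  rw [anytimeStep, Nat.add_sub_cancel, List.getD_eq_getElem _ _ hn']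
  rcases le_total i (n + 1) with h | h
  · exact (anytimeSched_prefix j h).getElem hn
  · exact ((anytimeSched_prefix j h).getElem hn').symm

lemma iterate_eq_gdIter {g : E → E} {j : ℝ → ℕ} {x : ℕ → E}
    (hx : ∀ t : ℕ, 1 ≤ t → x (t + 1) = x t - anytimeStep j t • g (x t)) (i n : ℕ)
    (hn : n ≤ (anytimeSched j i).length) :
    x (n + 1) = gdIter g (x 1) ((anytimeSched j i).take n) := by
  induction n with
  | zero => simp [gdIter]
  | succ n ih =>
    rw [List.take_succ_eq_append_getElem hn, gdIter_append, ← ih (by omega), hx (n + 1) (by omega),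
      getElem_anytimeSched]
    rfl

/-- Potential decrease along a primitive schedule. -/
lemma PrimitiveFor.potential_le {f : E → ℝ} {g : E → E} {L : List ℝ} (hp : PrimitiveFor f g L)
    (h : Cocoercive f g) (hL : ∀ a ∈ L, 0 < a) (hS : L = [] ∨ 1 ≤ L.sum) {u : E} (hu : g u = 0)
    (x : E) :
    (L.sum + 1) * (f (gdIter g x L) - f u + (L.sum + 1) / 2 * ‖g (gdIter g x L)‖ ^ 2)
      ≤ ‖x - u‖ ^ 2 := by
  have hlow : ∀ y, 2⁻¹ * ‖g y‖ ^ 2 ≤ f y - f u := fun y => by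
    have := h u y
    simp only [hu, inner_zero_left, zero_sub, norm_neg] at this
    linarith
  rcases hS with rfl | hS
  · have h1 := h x u
    have h2 := hlow x
    have h3 := sq_nonneg ‖g x - (x - u)‖
    rw [hu, sub_zero, ← neg_sub x u, inner_neg_right] at h1
    rw [norm_sub_sq_real] at h3
    simp only [List.sum_nil, gdIter]
    linarith
  · have h1 := hp.le_of_cocoercive h hL x u
    have h2 := hlow (gdIter g x L)
    simp only [hu, inner_zero_right, norm_zero] at h1
    set F := f (gdIter g x L) - f u
    have h3 : 0 ≤ F := le_trans (by positivity) h2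
    have h4 := sq_nonneg ‖gdIter g x L - u‖
    have h5 : 0 ≤ F + (L.sum + 1) / 2 * ‖g (gdIter g x L)‖ ^ 2 := by positivity
    nlinarith

/-- Convergence of the anytime schedule in terms of the total stepsize of the preceding blocks. -/
lemma Cocoercive.anytime_bound {f : E → ℝ} {g : E → E} (h : Cocoercive f g) {j : ℝ → ℕ}
    (hj : ∀ s, 0 ≤ s → (ρ ^ j s) ^ 2 ≤ s + 1) {u : E} (hu : g u = 0) {x : ℕ → E}
    (hx : ∀ t : ℕ, 1 ≤ t → x (t + 1) = x t - anytimeStep j t • g (x t)) {i n : ℕ}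
    (h1 : (anytimeSched j i).length ≤ n) (h2 : n ≤ (anytimeSched j (i + 1)).length) :
    ((anytimeSched j i).sum + 1) * (f (x (n + 1)) - f u) ≤ 10 * ‖x 1 - u‖ ^ 2 := by
  rw [iterate_eq_gdIter hx (i + 1) n h2]
  have hpot := (h.primitiveFor_anytimeSched j i).potential_le h (anytimeSched_pos j i)
    (anytimeSched_sum_eq_zero_or j i) hu (x 1)
  have hS := anytimeSched_sum_nonneg j i
  have hjS := hj _ hS
  obtain ⟨k, rfl⟩ := Nat.exists_eq_add_of_le h1
  rw [anytimeSched, concatSched, List.take_length_add_append, gdIter_append]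
  set z := gdIter g (x 1) (anytimeSched j i)
  set S := (anytimeSched j i).sum
  have hz : 0 ≤ f z - f u := by
    have := h u z
    simp only [hu, inner_zero_left, zero_sub, norm_neg] at this
    linarith [sq_nonneg ‖g z‖]
  suffices hs : f (gdIter g z ((phi S (silver (j S)).sum :: silver (j S)).take k)) - f z
      ≤ 5 * (S + 1) * ‖g z‖ ^ 2 by nlinarith
  rcases k with _ | k
  · simp only [List.take_zero, gdIter, sub_self]
    positivity
  · rw [List.take_succ_cons, gdIter]
    obtain ⟨hφ1, hφ2, -⟩ := phi_spec hS (silver_sum_nonneg (j S))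
    refine (h.silver_take (j S) k z _).trans (mul_le_mul_of_nonneg_right ?_ (sq_nonneg _))
    rw [silver_sum] at *
    nlinarith

/-- The exponent `q = (2 * logb 2 (1 + √2))⁻¹` satisfies `(1 + √2) ^ (2 * q) = 2`. -/
lemma two_pow_le_rpow {X : ℝ} {m : ℕ} (hm : (ρ ^ m) ^ 2 ≤ X) :
    (2 : ℝ) ^ m ≤ X ^ (2 * Real.logb 2 ρ)⁻¹ := by
  have hρ : 1 < ρ := by linarith [Real.sqrt_pos.2 (zero_lt_two (α := ℝ))]
  have hc : 0 < Real.logb 2 ρ := Real.logb_pos one_lt_two hρ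
  have h1 : ((ρ ^ m) ^ 2) ^ (2 * Real.logb 2 ρ)⁻¹ = (2 : ℝ) ^ m := by
    rw [← pow_mul, ← Real.rpow_natCast ρ, ← Real.rpow_mul (by linarith)]
    nth_rewrite 1 [← Real.rpow_logb zero_lt_two (by norm_num) (zero_lt_one.trans hρ)]
    rw [← Real.rpow_mul zero_le_two, ← Real.rpow_natCast 2 m]
    congr 1
    push_cast
    field_simp
  rw [← h1]
  exact Real.rpow_le_rpow (by positivity) hm (by positivity)

lemma anytimeSched_length_le {j : ℝ → ℕ}
    (hj : ∀ s, 0 ≤ s → (ρ ^ j s) ^ 2 ≤ s + 1 ∧ s + 1 < (ρ ^ (j s + 1)) ^ 2) (i : ℕ) :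
    ((anytimeSched j i).length : ℝ) ≤ 8 * (((anytimeSched j i).sum + 1) ^ (2 * Real.logb 2 ρ)⁻¹
      * √((anytimeSched j i).sum + 1)) := by
  have hρ1 : 1 ≤ ρ := by linarith [Real.sqrt_nonneg 2]
  have hρ2 : ρ ≤ 5 / 2 := by linarith [Real.sqrt_le_iff.2 (⟨by norm_num, by norm_num⟩ :
    (0 : ℝ) ≤ 3 / 2 ∧ (2 : ℝ) ≤ (3 / 2) ^ 2)]
  have hq : 0 ≤ (2 * Real.logb 2 ρ)⁻¹ :=
    inv_nonneg.2 (mul_nonneg zero_le_two (Real.logb_nonneg one_lt_two hρ1))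
  induction i with
  | zero => simp [anytimeSched]
  | succ i ih =>
    rw [anytimeSched_length_succ]
    have hS := anytimeSched_sum_nonneg j i
    obtain ⟨h1, h2⟩ := hj _ hS
    have hgrow : (anytimeSched j i).sum + 1 + ρ ^ j (anytimeSched j i).sum
        ≤ (anytimeSched j (i + 1)).sum + 1 := by
      rw [anytimeSched, concatSched, List.sum_append, List.sum_cons]
      have := (phi_spec hS (silver_sum_nonneg (j (anytimeSched j i).sum))).1
      rw [silver_sum] at *
      linarith
    have h3 := two_pow_le_rpow h1
    set X := (anytimeSched j i).sum + 1
    set X' := (anytimeSched j (i + 1)).sum + 1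
    set r := ρ ^ j (anytimeSched j i).sum
    set q := (2 * Real.logb 2 ρ)⁻¹
    have hr : 1 ≤ r := one_le_pow₀ hρ1
    have hX : 0 < X := by positivity
    have hs1 : r ≤ √X := Real.le_sqrt_of_sq_le h1
    have hs2 : √X ≤ 5 / 2 * r := by
      refine (Real.sqrt_le_iff.2 ⟨by positivity, h2.le⟩).trans ?_
      rw [pow_succ, mul_comm]
      exact mul_le_mul_of_nonneg_right hρ2 (by positivity)
    have hs3 : √X + 1 / 8 ≤ √X' := by
      refine Real.le_sqrt_of_sq_le (le_trans ?_ hgrow)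
      nlinarith [Real.sq_sqrt hX.le]
    have h4 : X ^ q ≤ X' ^ q := Real.rpow_le_rpow hX.le (by linarith) hq
    push_cast
    calc ((anytimeSched j i).length : ℝ) + 2 ^ j (anytimeSched j i).sum
        ≤ 8 * (X ^ q * √X) + X ^ q := add_le_add ih h3
      _ = 8 * (X ^ q * (√X + 1 / 8)) := by ring
      _ ≤ 8 * (X' ^ q * √X') := by
        have := (Real.rpow_nonneg hX.le q).trans h4
        gcongr

/-- anytime stepsize-based acceleration of gradient descent,
with rate exponent `θ = 2·log₂(1+√2)/(1+log₂(1+√2))`. -/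
theorem anytime_accelerated_gradient_descent :
    ∃ (α : ℕ → ℝ) (C : ℝ),
      (∀ t : ℕ, 1 ≤ t → 0 < α t) ∧ 0 < C ∧
      ∀ (d : ℕ) (f : EuclideanSpace ℝ (Fin d) → ℝ)
        (g : EuclideanSpace ℝ (Fin d) → EuclideanSpace ℝ (Fin d)),
        ConvexOn ℝ Set.univ f →
        (∀ y, HasGradientAt f (g y) y) →
        LipschitzWith 1 g →
        ∀ xstar : EuclideanSpace ℝ (Fin d), IsMinOn f Set.univ xstar →
        ∀ x : ℕ → EuclideanSpace ℝ (Fin d),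
          (∀ t : ℕ, 1 ≤ t → x (t + 1) = x t - α t • g (x t)) →
          ∀ T : ℕ, 1 ≤ T →
            f (x T) - f xstar ≤
              C * ‖x 1 - xstar‖ ^ 2 /
                (T : ℝ) ^ (2 * Real.logb 2 (1 + Real.sqrt 2) /
                  (1 + Real.logb 2 (1 + Real.sqrt 2))) := by
  have hρ1 : 1 < ρ := by linarith [Real.sqrt_pos.2 (zero_lt_two (α := ℝ))]
  have hj : ∀ s : ℝ, ∃ m : ℕ, 0 ≤ s → (ρ ^ m) ^ 2 ≤ s + 1 ∧ s + 1 < (ρ ^ (m + 1)) ^ 2 := by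
    intro s
    by_cases hs : 0 ≤ s
    · obtain ⟨m, h1, h2⟩ := exists_nat_pow_near (show 1 ≤ s + 1 by linarith)
        (one_lt_pow₀ hρ1 two_ne_zero)
      exact ⟨m, fun _ => ⟨by rwa [pow_right_comm], by rwa [pow_right_comm]⟩⟩
    · exact ⟨0, fun h => absurd h hs⟩
  choose j hj using hj
  refine ⟨anytimeStep j, 10 * 9 ^ (2 * Real.logb 2 ρ / (1 + Real.logb 2 ρ)),
    fun t _ => anytimeStep_pos j t, by positivity, ?_⟩
  intro d f g hf hg hl u hu x hx T hT
  obtain ⟨n, rfl⟩ := Nat.exists_eq_add_of_le' hT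
  obtain ⟨i, h1, h2⟩ : ∃ i, (anytimeSched j i).length ≤ n ∧
      n < (anytimeSched j (i + 1)).length := by
    have hex : ∃ i, n < (anytimeSched j i).length := ⟨n + 1, le_anytimeSched_length j (n + 1)⟩
    classical
    obtain ⟨i, hi⟩ : ∃ i, Nat.find hex = i + 1 :=
      Nat.exists_eq_succ_of_ne_zero fun h0 => by simpa [h0, anytimeSched] using Nat.find_spec hex
    exact ⟨i, not_lt.1 (Nat.find_min hex (by omega)), hi ▸ Nat.find_spec hex⟩
  have hS := anytimeSched_sum_nonneg j i
  have hb := (hf.cocoercive hg hl).anytime_bound (fun s hs => (hj s hs).1)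
    (gradient_eq_zero_of_isMinOn hg hu) hx h1 h2.le
  have hlen := anytimeSched_length_le hj i
  have hblock := two_pow_le_rpow (hj _ hS).1
  rw [anytimeSched_length_succ] at h2
  have hT' : ((n + 1 : ℕ) : ℝ) ≤ (anytimeSched j i).length + 2 ^ j (anytimeSched j i).sum := by
    exact_mod_cast h2
  set X := (anytimeSched j i).sum + 1
  have hc : 0 < Real.logb 2 ρ := Real.logb_pos one_lt_two hρ1
  set c := Real.logb 2 ρ
  have hX : 1 ≤ X := by linarith
  have hsX : 1 ≤ √X := Real.one_le_sqrt.2 hX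
  have hTX : ((n + 1 : ℕ) : ℝ) ≤ 9 * (X ^ (2 * c)⁻¹ * √X) := by
    have : X ^ (2 * c)⁻¹ * 1 ≤ X ^ (2 * c)⁻¹ * √X := by gcongr
    linarith
  have hpow : ((n + 1 : ℕ) : ℝ) ^ (2 * c / (1 + c)) ≤ 9 ^ (2 * c / (1 + c)) * X := by
    refine (Real.rpow_le_rpow (by positivity) hTX (by positivity)).trans_eq ?_
    rw [Real.mul_rpow (by norm_num) (by positivity), Real.sqrt_eq_rpow,
      ← Real.rpow_add (by linarith), ← Real.rpow_mul (by linarith)]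
    have : ((2 * c)⁻¹ + 1 / 2) * (2 * c / (1 + c)) = 1 := by
      field_simp
    rw [this, Real.rpow_one]
  rw [le_div_iff₀ (by positivity)]
  have hF : 0 ≤ f (x (n + 1)) - f u := sub_nonneg.2 (hu (Set.mem_univ _))
  have h9 : (0 : ℝ) ≤ 9 ^ (2 * c / (1 + c)) := by positivity
  calc (f (x (n + 1)) - f u) * ((n + 1 : ℕ) : ℝ) ^ (2 * c / (1 + c))
      ≤ (f (x (n + 1)) - f u) * (9 ^ (2 * c / (1 + c)) * X) := mul_le_mul_of_nonneg_left hpow hF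
    _ = 9 ^ (2 * c / (1 + c)) * (X * (f (x (n + 1)) - f u)) := by ring
    _ ≤ 9 ^ (2 * c / (1 + c)) * (10 * ‖x 1 - u‖ ^ 2) := mul_le_mul_of_nonneg_left hb h9
    _ = 10 * 9 ^ (2 * c / (1 + c)) * ‖x 1 - u‖ ^ 2 := by ring
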